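/- Ky Fan norm of a power of a sum: let C_1, ..., C_m be n×n complex matrices (or symmetric T-product tensors), s ≥ 1 a real number, and k ∈ {1,...,n}. Then the sum of the k largest singular values of |Σ_i C_i|^s satisfies ‖|Σ_{i=1}^m C_i|^s‖_{(k)} ≤ m^{s−1} Σ_{i=1}^m ‖|C_i|^s‖_{(k)}, where ‖A‖_{(k)} denotes the Ky Fan k-norm (sum of the k largest singular values of A). -/

import Mathlib

open Finset
open scoped ComplexOrder

/-- The Ky Fan-type quantity `‖|A|^s‖_(k) = ∑_{j=1}^k σ_j(A)^s`: the sum of the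
`k` largest values among the `s`-th powers of the singular values of `A`
(the singular values are the square roots of the eigenvalues of `Aᴴ * A`). -/
noncomputable def kyFanPow {n : ℕ} (A : Matrix (Fin n) (Fin n) ℂ) (s : ℝ) (k : ℕ) : ℝ :=
  ⨆ T : {T : Finset (Fin n) // T.card = k},
    ∑ j ∈ T.1,
      Real.sqrt ((Matrix.posSemidef_conjTranspose_mul_self A).1.eigenvalues j) ^ s

/-- The singular values of a square complex matrix, in the order of the eigenvalues of `Aᴴ * A`. -/
noncomputable def Matrix.singularValue {n : ℕ} (A : Matrix (Fin n) (Fin n) ℂ) (j : Fin n) : ℝ :=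
  Real.sqrt ((Matrix.posSemidef_conjTranspose_mul_self A).1.eigenvalues j)

lemma Matrix.singularValue_nonneg {n : ℕ} (A : Matrix (Fin n) (Fin n) ℂ) (j : Fin n) :
    0 ≤ A.singularValue j :=
  Real.sqrt_nonneg _

lemma sum_singularValue_rpow_le_kyFanPow {n : ℕ} (A : Matrix (Fin n) (Fin n) ℂ) (s : ℝ)
    (T : Finset (Fin n)) : ∑ j ∈ T, A.singularValue j ^ s ≤ kyFanPow A s T.card :=
  le_ciSup (f := fun S : {S : Finset (Fin n) // S.card = T.card} =>
    ∑ j ∈ S.1, A.singularValue j ^ s) (Set.finite_range _).bddAbove ⟨T, rfl⟩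

/-- **Singular value decomposition** of a square complex matrix. -/
lemma Matrix.exists_orthonormalBasis_toEuclideanLin_eq_smul {n : ℕ}
    (A : Matrix (Fin n) (Fin n) ℂ) :
    ∃ x y : OrthonormalBasis (Fin n) ℂ (EuclideanSpace ℂ (Fin n)),
      ∀ j, A.toEuclideanLin (x j) = (A.singularValue j : ℂ) • y j := by
  have hA := Matrix.posSemidef_conjTranspose_mul_self A
  set x := hA.1.eigenvectorBasis
  have h_sq (j : Fin n) : (A.singularValue j : ℂ) ^ 2 = hA.1.eigenvalues j := by
    rw [← Complex.ofReal_pow, Matrix.singularValue, Real.sq_sqrt (hA.eigenvalues_nonneg j)]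
  have h_eig (j : Fin n) : A.conjTranspose.toEuclideanLin (A.toEuclideanLin (x j)) =
      (A.singularValue j : ℂ) ^ 2 • x j := by
    have h := hA.1.mulVec_eigenvectorBasis j
    ext i
    have h_i := congrFun h i
    rw [← Matrix.mulVec_mulVec] at h_i
    rw [h_sq]
    simpa [Matrix.toLpLin_apply] using h_i
  have h_inner (i j : Fin n) : inner ℂ (A.toEuclideanLin (x i)) (A.toEuclideanLin (x j)) =
      if i = j then (A.singularValue j : ℂ) ^ 2 else 0 := by
    rw [← LinearMap.adjoint_inner_right, ← Matrix.toEuclideanLin_conjTranspose_eq_adjoint, h_eig,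
      inner_smul_right, orthonormal_iff_ite.mp x.orthonormal]
    simp
  let v (j : Fin n) : EuclideanSpace ℂ (Fin n) :=
    (A.singularValue j : ℂ)⁻¹ • A.toEuclideanLin (x j)
  have hv : Orthonormal ℂ ({j | A.singularValue j ≠ 0}.domRestrict v) := by
    rw [orthonormal_iff_ite]
    rintro ⟨i, hi⟩ ⟨j, hj⟩
    have hj' : (A.singularValue j : ℂ) ≠ 0 := by exact_mod_cast hj
    simp only [Set.domRestrict_apply, v, inner_smul_left, inner_smul_right, h_inner,
      Subtype.mk.injEq]
    split_ifs with hij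
    · subst hij
      simp only [map_inv₀, Complex.conj_ofReal]
      field_simp
    · simp
  obtain ⟨y, hy⟩ := hv.exists_orthonormalBasis_extension_of_card_eq (by simp)
  refine ⟨x, y, fun j => ?_⟩
  by_cases hj : A.singularValue j = 0
  · have h := h_inner j j
    simp only [hj, if_true, Complex.ofReal_zero, ne_eq, OfNat.ofNat_ne_zero, not_false_eq_true,
      zero_pow, inner_self_eq_zero] at h
    simp [hj, h]
  · have hj' : (A.singularValue j : ℂ) ≠ 0 := by exact_mod_cast hj
    rw [hy j hj, smul_inv_smul₀ hj']

lemma sum_doublyStochastic_mul_singularValue_rpow_le_kyFanPow {n : ℕ}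
    (A : Matrix (Fin n) (Fin n) ℂ) (s : ℝ) (T : Finset (Fin n)) {P : Matrix (Fin n) (Fin n) ℝ}
    (hP : P ∈ doublyStochastic ℝ (Fin n)) :
    ∑ j ∈ T, ∑ l, P j l * A.singularValue l ^ s ≤ kyFanPow A s T.card := by
  obtain ⟨w, hw, hw_sum, rfl⟩ := exists_eq_sum_perm_of_mem_doublyStochastic hP
  have h_perm (σ : Equiv.Perm (Fin n)) :
      ∑ j ∈ T, A.singularValue (σ j) ^ s ≤ kyFanPow A s T.card := by
    simpa using sum_singularValue_rpow_le_kyFanPow A s (T.map σ.toEmbedding)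
  calc ∑ j ∈ T, ∑ l, (∑ σ, w σ • σ.permMatrix ℝ) j l * A.singularValue l ^ s
      = ∑ j ∈ T, ∑ σ, w σ * A.singularValue (σ j) ^ s := by
        refine sum_congr rfl fun j _ => ?_
        simp only [Matrix.sum_apply, Matrix.smul_apply, sum_mul]
        rw [sum_comm]
        simp
    _ = ∑ σ, w σ * ∑ j ∈ T, A.singularValue (σ j) ^ s := by
        rw [sum_comm]
        simp only [mul_sum]
    _ ≤ ∑ σ, w σ * kyFanPow A s T.card :=
        sum_le_sum fun σ _ => mul_le_mul_of_nonneg_left (h_perm σ) (hw σ)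
    _ = kyFanPow A s T.card := by rw [← sum_mul, hw_sum, one_mul]

/-- The `s`-th powers of the diagonal entries of a matrix with respect to a pair of orthonormal
bases are dominated by those of its singular values. -/
lemma sum_norm_inner_rpow_le_kyFanPow {n : ℕ} (A : Matrix (Fin n) (Fin n) ℂ) {s : ℝ} (hs : 1 ≤ s)
    (u v : OrthonormalBasis (Fin n) ℂ (EuclideanSpace ℂ (Fin n))) (T : Finset (Fin n)) :
    ∑ j ∈ T, ‖inner ℂ (u j) (A.toEuclideanLin (v j))‖ ^ s ≤ kyFanPow A s T.card := by
  obtain ⟨x, y, hxy⟩ := A.exists_orthonormalBasis_toEuclideanLin_eq_smul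
  let P : Matrix (Fin n) (Fin n) ℝ := Matrix.of fun j l =>
    (‖inner ℂ (u j) (y l)‖ ^ 2 + ‖inner ℂ (x l) (v j)‖ ^ 2) / 2
  have hP : P ∈ doublyStochastic ℝ (Fin n) := by
    refine mem_doublyStochastic_iff_sum.mpr ⟨fun j l => ?_, fun j => ?_, fun l => ?_⟩
    · simp only [P, Matrix.of_apply]
      positivity
    · simp [P, ← sum_div, sum_add_distrib, y.sum_sq_norm_inner_left, x.sum_sq_norm_inner_right]
    · simp [P, ← sum_div, sum_add_distrib, u.sum_sq_norm_inner_right, v.sum_sq_norm_inner_left]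
  refine le_trans (sum_le_sum fun j _ => ?_)
    (sum_doublyStochastic_mul_singularValue_rpow_le_kyFanPow A s T hP)
  have h_expand : inner ℂ (u j) (A.toEuclideanLin (v j)) =
      ∑ l, inner ℂ (x l) (v j) * ((A.singularValue l : ℂ) * inner ℂ (u j) (y l)) := by
    conv_lhs => rw [← x.sum_repr' (v j)]
    simp only [map_sum, map_smul, hxy, inner_sum, inner_smul_right]
  have h_le : ‖inner ℂ (u j) (A.toEuclideanLin (v j))‖ ≤ ∑ l, P j l * A.singularValue l := by
    rw [h_expand]
    refine (norm_sum_le _ _).trans (sum_le_sum fun l _ => ?_)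
    simp only [norm_mul, Complex.norm_real, Real.norm_of_nonneg (A.singularValue_nonneg l), P,
      Matrix.of_apply]
    nlinarith [mul_nonneg (A.singularValue_nonneg l)
      (sq_nonneg (‖inner ℂ (u j) (y l)‖ - ‖inner ℂ (x l) (v j)‖))]
  exact (Real.rpow_le_rpow (norm_nonneg _) h_le (by linarith)).trans
    (Real.rpow_arith_mean_le_arith_mean_rpow _ _ _ (fun l _ => hP.1 j l)
      (sum_row_of_mem_doublyStochastic hP j) (fun l _ => A.singularValue_nonneg l) hs)

/-- **Ky Fan norm of a power of a sum** (Lemma on Ky Fan inequalities for sums of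
tensors): for `n×n` complex matrices `C_1, …, C_m`, `s ≥ 1` and `k ∈ {1,…,n}`,
`‖|∑_i C_i|^s‖_(k) ≤ m^(s−1) ∑_i ‖|C_i|^s‖_(k)`. -/
theorem kyFan_pow_sum_le {n : ℕ} (m : ℕ) (hm : 1 ≤ m)
    (C : Fin m → Matrix (Fin n) (Fin n) ℂ)
    (s : ℝ) (hs : 1 ≤ s) (k : ℕ) (hk1 : 1 ≤ k) (hkn : k ≤ n) :
    kyFanPow (∑ i, C i) s k ≤ (m : ℝ) ^ (s - 1) * ∑ i, kyFanPow (C i) s k := by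
  have : Nonempty {T : Finset (Fin n) // T.card = k} := by
    obtain ⟨T, -, hT⟩ := exists_subset_card_eq (s := (univ : Finset (Fin n))) (by simpa using hkn)
    exact ⟨⟨T, hT⟩⟩
  refine ciSup_le ?_
  rintro ⟨T, rfl⟩
  change ∑ j ∈ T, (∑ i, C i).singularValue j ^ s ≤ _
  obtain ⟨v, u, hvu⟩ := (∑ i, C i).exists_orthonormalBasis_toEuclideanLin_eq_smul
  have h_term (j : Fin n) : (∑ i, C i).singularValue j ^ s ≤
      (m : ℝ) ^ (s - 1) * ∑ i, ‖inner ℂ (u j) ((C i).toEuclideanLin (v j))‖ ^ s := by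
    have h_inner : ((∑ i, C i).singularValue j : ℂ) =
        ∑ i, inner ℂ (u j) ((C i).toEuclideanLin (v j)) := by
      rw [← inner_sum, ← LinearMap.sum_apply, ← map_sum, hvu, inner_smul_right,
        inner_self_eq_norm_sq_to_K, u.orthonormal.1 j]
      simp
    have h_le : (∑ i, C i).singularValue j ≤
        ∑ i, ‖inner ℂ (u j) ((C i).toEuclideanLin (v j))‖ := by
      rw [← Real.norm_of_nonneg (Matrix.singularValue_nonneg _ j), ← Complex.norm_real, h_inner]
      exact norm_sum_le _ _
    refine (Real.rpow_le_rpow (Matrix.singularValue_nonneg _ j) h_le (by linarith)).trans ?_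
    simpa using Real.rpow_sum_le_const_mul_sum_rpow_of_nonneg univ hs
      (f := fun i => ‖inner ℂ (u j) ((C i).toEuclideanLin (v j))‖) fun i _ => norm_nonneg _
  calc ∑ j ∈ T, (∑ i, C i).singularValue j ^ s
      ≤ ∑ j ∈ T, (m : ℝ) ^ (s - 1) *
          ∑ i, ‖inner ℂ (u j) ((C i).toEuclideanLin (v j))‖ ^ s :=
        sum_le_sum fun j _ => h_term j
    _ = (m : ℝ) ^ (s - 1) *
          ∑ i, ∑ j ∈ T, ‖inner ℂ (u j) ((C i).toEuclideanLin (v j))‖ ^ s := by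
        rw [← mul_sum, sum_comm]
    _ ≤ (m : ℝ) ^ (s - 1) * ∑ i, kyFanPow (C i) s T.card := by
        gcongr with i
        exact sum_norm_inner_rpow_le_kyFanPow (C i) hs u v T
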